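/- arXiv:2208.07793 — 4 statements merged into one kernel-verified Lean document; each statement's English description precedes it below -/
import Mathlib

section
/- Let G be a finite group and let N be a minimal normal subgroup of G that is not solvable. Suppose that cod(χ) ≤ χ(1)^2 for every nonlinear irreducible complex character χ of G. Then N is a nonabelian simple group. -/
open CategoryTheory Module

theorem lemD {V : Type*} [AddCommGroup V] [Module ℂ V] [FiniteDimensional ℂ V]
    (A : Module.End ℂ V) (k : ℕ) (hk : 0 < k) (hA : A ^ k = 1)
    (ht : LinearMap.trace ℂ V A = finrank ℂ V) : A = 1 := by
  have hsplit : A.charpoly.Splits := IsAlgClosed.splits _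
  have htr : LinearMap.trace ℂ V A = A.charpoly.roots.sum := by
    exact Module.End.trace_eq_sum_roots_charpoly_of_splits hsplit
  have hcard : A.charpoly.roots.card = finrank ℂ V := by
    rw [← hsplit.natDegree_eq_card_roots, LinearMap.charpoly_natDegree]
  have hroot : ∀ z ∈ A.charpoly.roots, z ^ k = 1 := by
    intro z hz
    have h1 := (Polynomial.mem_roots'.1 hz).2
    have h2 : A.HasEigenvalue z := by
      rw [Module.End.hasEigenvalue_iff_isRoot_charpoly]; exact h1
    obtain ⟨v, hv⟩ := h2.exists_hasEigenvector
    have := hv.pow_apply k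
    rw [hA] at this
    have h3 : (1 - z ^ k) • v = 0 := by rw [sub_smul, ← this]; simp
    rcases smul_eq_zero.1 h3 with h | h
    · exact (sub_eq_zero.1 h).symm
    · exact absurd h hv.2
  have hre : ∀ z ∈ A.charpoly.roots, z.re ≤ 1 := by
    intro z hz
    have : ‖z‖ = 1 := by
      have := congrArg norm (hroot z hz)
      rw [norm_pow, norm_one] at this
      exact (pow_eq_one_iff_of_nonneg (norm_nonneg _) hk.ne').1 this
    exact this ▸ Complex.re_le_norm z
  have hall : ∀ z ∈ A.charpoly.roots, z = 1 := by
    have hs : (A.charpoly.roots.map (fun z => 1 - z.re)).sum = 0 := by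
      rw [Multiset.sum_map_sub]
      have : (A.charpoly.roots.map (fun z => z.re)).sum = (A.charpoly.roots.sum).re := by
        exact (map_multiset_sum Complex.reLm _).symm
      rw [this, ← htr, ht]; simp [hcard]
    intro z hz
    have hz0 : 1 - z.re = 0 := by
      refine Multiset.all_zero_of_le_zero_le_of_sum_eq_zero ?_ hs _ (Multiset.mem_map_of_mem (fun z : ℂ => 1 - z.re) hz)
      intro x hx
      obtain ⟨w, hw, rfl⟩ := Multiset.mem_map.1 hx
      linarith [hre w hw]
    have hn : ‖z‖ = 1 := by
      have := congrArg norm (hroot z hz)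
      rw [norm_pow, norm_one] at this
      exact (pow_eq_one_iff_of_nonneg (norm_nonneg _) hk.ne').1 this
    have h4 : z.re ^ 2 + z.im ^ 2 = 1 := by
      have := Complex.sq_norm z
      rw [hn, Complex.normSq_apply] at this; nlinarith
    apply Complex.ext
    · simp; linarith
    · have : z.re = 1 := by linarith
      rw [this] at h4; simp; nlinarith
  have hss : A.IsSemisimple := by
    refine Module.End.isSemisimple_of_squarefree_aeval_eq_zero
      (p := Polynomial.X ^ k - Polynomial.C 1) ?_ (by simp [hA])
    exact (Polynomial.separable_X_pow_sub_C (1:ℂ) (by exact_mod_cast hk.ne') one_ne_zero).squarefree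
  have hss1 : (A - algebraMap ℂ (Module.End ℂ V) 1).IsSemisimple :=
    Module.End.isSemisimple_sub_algebraMap_iff.2 hss
  have hrep : A.charpoly.roots = Multiset.replicate (finrank ℂ V) 1 :=
    Multiset.eq_replicate.2 ⟨hcard, hall⟩
  have hcp : A.charpoly = (Polynomial.X - Polynomial.C 1) ^ (finrank ℂ V) := by
    rw [hsplit.eq_prod_roots_of_monic A.charpoly_monic, hrep]; simp
  have hnil : IsNilpotent (A - algebraMap ℂ (Module.End ℂ V) 1) := by
    refine ⟨finrank ℂ V, ?_⟩
    have := A.aeval_self_charpoly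
    rw [hcp] at this
    simpa using this
  have := Module.End.eq_zero_of_isNilpotent_isSemisimple hnil hss1
  simpa [sub_eq_zero] using this

theorem lemB {G : Type} [Group G] [Fintype G] {V : Type} [AddCommGroup V] [Module ℂ V]
    [FiniteDimensional ℂ V] (ρ : Representation ℂ G V) (h : ρ.IsIrreducible) :
    Simple (FDRep.of ρ) := by
  classical
  rw [FDRep.simple_iff_char_is_norm_one]
  have : Invertible (Nat.card G : ℂ) := invertibleOfNonzero (NeZero.ne (Nat.card G : ℂ))
  have h1 := Representation.char_orthonormal ρ ρ
  rw [if_pos ⟨Representation.Equiv.refl ρ⟩, inv_mul_eq_one₀ (NeZero.ne (Nat.card G : ℂ))] at h1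
  exact h1.symm

open scoped MonoidAlgebra in
theorem lemC {G : Type} [Group G] [Fintype G] {V : Type} [AddCommGroup V] [Module ℂ V]
    [FiniteDimensional ℂ V] (ρ : Representation ℂ G V) (h : ρ.IsIrreducible)
    (K : Subgroup G) (hK : ∀ k ∈ K, ρ k = 1) :
    finrank ℂ V ^ 2 * Nat.card K ≤ Nat.card G := by
  classical
  have hspan : Submodule.span ℂ (Set.range (fun g => (ρ g : Module.End ℂ V))) = ⊤ := by
    rw [eq_top_iff]
    rintro f -
    have hbij := IsSimpleModule.algebraMap_end_bijective_of_isAlgClosed (A := ℂ[G])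
      (V := ρ.asModule) ℂ
    let f' : Module.End (Module.End ℂ[G] ρ.asModule) ρ.asModule :=
      { toFun := fun v => (f v : V)
        map_add' := fun x y => f.map_add x y
        map_smul' := by
          intro e x
          obtain ⟨c, rfl⟩ := hbij.2 e
          exact f.map_smul c x }
    obtain ⟨s, hs⟩ := Module.Finite.fg_top (R := ℂ) (M := V)
    obtain ⟨r, hr⟩ := jacobson_density f' s
    have hf : f = ρ.asAlgebraHom r := by
      apply LinearMap.ext_on hs
      intro v hv
      exact hr v hv
    rw [hf]
    clear hf hr f' f
    induction r using MonoidAlgebra.induction_linear with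
    | zero => simp
    | add x y hx hy => rw [map_add]; exact Submodule.add_mem _ hx hy
    | single g a =>
      rw [Representation.asAlgebraHom_single]
      exact Submodule.smul_mem _ _ (Submodule.subset_span ⟨g, rfl⟩)
  let φ : G ⧸ K → Module.End ℂ V := Quotient.lift (fun g => ρ g) (by
    intro a b hab
    have := hK _ (QuotientGroup.leftRel_apply.1 hab)
    have h2 : ρ b = ρ a * ρ (a⁻¹ * b) := by rw [← map_mul]; simp
    rw [h2, this, mul_one])
  have hr : Set.range φ = Set.range (fun g => (ρ g : Module.End ℂ V)) := by
    ext x; constructor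
    · rintro ⟨q, rfl⟩
      induction q using Quotient.inductionOn with | h g => exact ⟨g, rfl⟩
    · rintro ⟨g, rfl⟩; exact ⟨QuotientGroup.mk g, rfl⟩
  rw [← hr] at hspan
  have h1 : finrank ℂ (Module.End ℂ V) ≤ Fintype.card (G ⧸ K) := by
    rw [← finrank_top, ← hspan]
    exact finrank_range_le_card φ
  have h2 := K.index_mul_card
  rw [Module.finrank_linearMap] at h1
  rw [← h2, Subgroup.index, Nat.card_eq_fintype_card (α := G ⧸ K), pow_two]
  exact Nat.mul_le_mul_right _ h1

theorem lemA {G : Type} [Group G] [Finite G] {V : Type} [AddCommGroup V] [Module ℂ V]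
    (ρ : Representation ℂ G V) (g : G) (hg : ρ g ≠ 1) :
    ∃ σ : Subrepresentation ρ, IsAtom σ ∧ ∃ v ∈ σ, ρ g v ≠ v := by
  by_contra! hc
  apply hg
  have htop := IsSemisimpleModule.sSup_simples_eq_top (MonoidAlgebra ℂ G) ρ.asModule
  let E : Submodule ℂ V := LinearMap.eqLocus (ρ g) 1
  have : ∀ x : V, x ∈ (⊤ : Submodule (MonoidAlgebra ℂ G) ρ.asModule) → x ∈ E := by
    rw [← htop]
    intro x hx
    rw [sSup_eq_iSup'] at hx
    refine Submodule.iSup_induction (M := ρ.asModule) _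
      (motive := fun x : ρ.asModule => ρ g (x : V) = (x : V)) hx ?_ (map_zero (ρ g))
      (fun x y hx hy => E.add_mem (x := (x : V)) (y := (y : V)) hx hy)
    rintro ⟨m, hm⟩ x hx
    have hat : IsAtom (Subrepresentation.subrepresentationSubmoduleOrderIso.symm m) := by
      rw [OrderIso.isAtom_iff]
      exact isSimpleModule_iff_isAtom.1 hm
    exact hc _ hat x hx
  ext v
  exact this v trivial

theorem lemAtom {G : Type} [Group G] {V : Type} [AddCommGroup V] [Module ℂ V]
    (ρ : Representation ℂ G V) (σ : Subrepresentation ρ) (h : IsAtom σ) :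
    σ.toRepresentation.IsIrreducible := by
  let up : Subrepresentation σ.toRepresentation → Subrepresentation ρ := fun τ =>
    ⟨τ.toSubmodule.map σ.toSubmodule.subtype, by
      rintro g _ ⟨v, hv, rfl⟩
      exact ⟨σ.toRepresentation g v, τ.apply_mem_toSubmodule g hv, rfl⟩⟩
  have hup : ∀ τ, up τ ≤ σ := by
    rintro τ _ ⟨v, hv, rfl⟩; exact v.2
  have hinj : ∀ τ τ', up τ = up τ' → τ = τ' := by
    intro τ τ' he
    apply Subrepresentation.toSubmodule_injective
    exact Submodule.map_injective_of_injective σ.toSubmodule.injective_subtype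
      (congrArg Subrepresentation.toSubmodule he)
  have hbot : up ⊥ = ⊥ := Subrepresentation.toSubmodule_injective (Submodule.map_bot _)
  have htop : up ⊤ = σ := Subrepresentation.toSubmodule_injective (by
    exact Submodule.map_subtype_top _)
  refine { exists_pair_ne := ⟨⊥, ⊤, fun he => h.1 ?_⟩, eq_bot_or_eq_top := fun τ => ?_ }
  · rw [← htop, ← he, hbot]
  · rcases h.le_iff.1 (hup τ) with h1 | h1
    · left; exact hinj _ _ (h1.trans hbot.symm)
    · right; exact hinj _ _ (h1.trans htop.symm)

def permRep (H Ω : Type) [Group H] [MulAction H Ω] : Representation ℂ H (Ω → ℂ) where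
  toFun h := { toFun := fun f x => f (h⁻¹ • x), map_add' := fun _ _ => rfl,
               map_smul' := fun _ _ => rfl }
  map_one' := by ext; simp
  map_mul' a b := by
    refine LinearMap.ext fun f => funext fun x => ?_
    simp [mul_smul]

theorem permRep_apply (H Ω : Type) [Group H] [MulAction H Ω] (h : H) (f : Ω → ℂ) (x : Ω) :
    permRep H Ω h f x = f (h⁻¹ • x) := rfl

theorem lemE {H : Type} [Group H] [Finite H] {Ω : Type} [Fintype Ω] [MulAction H Ω]
    (g : H) (ω : Ω) (hg : g • ω ≠ ω) :
    ∃ (W : Type) (_ : AddCommGroup W) (_ : Module ℂ W) (_ : FiniteDimensional ℂ W)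
      (σ : Representation ℂ H W), σ.IsIrreducible ∧ σ g ≠ 1 ∧ finrank ℂ W < Fintype.card Ω ∧
      ∀ k : H, (∀ x : Ω, k • x = x) → σ k = 1 := by
  classical
  let ρ := permRep H Ω
  have hρ : ρ g ≠ 1 := by
    intro he
    have h1 := congrFun (congrArg (fun f => f (Pi.single ω (1:ℂ))) he) (g • ω)
    simp only [ρ, permRep_apply, Module.End.one_apply, inv_smul_smul, Pi.single_eq_same] at h1
    rw [Pi.single_eq_of_ne hg] at h1
    exact one_ne_zero h1
  obtain ⟨σ, hat, v, hv, hgv⟩ := lemA ρ g hρ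
  refine ⟨σ.toSubmodule, inferInstance, inferInstance, inferInstance, σ.toRepresentation,
    lemAtom ρ σ hat, ?_, ?_, ?_⟩
  · intro he
    have := congrArg (fun f => ((f ⟨v, hv⟩ : σ.toSubmodule) : Ω → ℂ)) he
    exact hgv this
  · have hlt : σ.toSubmodule < ⊤ := by
      rw [lt_top_iff_ne_top]
      intro ht
      let u : Ω → ℂ := fun _ => 1
      have hu : ∀ h : H, ρ h u = u := by
        intro h
        rfl
      let L : Subrepresentation ρ := ⟨Submodule.span ℂ {u}, by
        intro h x hx
        obtain ⟨c, rfl⟩ := Submodule.mem_span_singleton.1 hx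
        rw [map_smul, hu]
        exact hx⟩
      have hσ : σ = ⊤ := Subrepresentation.toSubmodule_injective ht
      have hL : L ≤ σ := hσ ▸ le_top
      rcases hat.le_iff.1 hL with h1 | h1
      · have : u ∈ (⊥ : Submodule ℂ (Ω → ℂ)) := by
          have h2 : L.toSubmodule = ⊥ := congrArg Subrepresentation.toSubmodule h1
          rw [← h2]; exact Submodule.mem_span_singleton_self u
        have h3 : u ω = 0 := by rw [(Submodule.mem_bot ℂ).1 this]; rfl
        simp [u] at h3
      · have h2 : L.toSubmodule = σ.toSubmodule := congrArg Subrepresentation.toSubmodule h1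
        have h3 : v ∈ L.toSubmodule := h2 ▸ hv
        obtain ⟨c, rfl⟩ := Submodule.mem_span_singleton.1 h3
        exact hgv (by rw [map_smul, hu])
    have := Submodule.finrank_lt hlt.ne
    simpa using this
  · intro k hk
    refine LinearMap.ext fun ⟨x, hx⟩ => Subtype.ext ?_
    have : ρ k x = x := by
      have h1 : ρ k = 1 := by
        refine LinearMap.ext fun f => funext fun b => ?_
        have : k⁻¹ • b = b := by rw [inv_smul_eq_iff, hk]
        simp only [ρ, permRep_apply, this, Module.End.one_apply]
      rw [h1]; rfl
    exact this

theorem lemF {G : Type} [Group G] [Fintype G] (H : Subgroup G) {W : Type} [AddCommGroup W]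
    [Module ℂ W] [FiniteDimensional ℂ W] (σ : Representation ℂ H W)
    (s : H) (hs : σ s ≠ 1) :
    ∃ (V : Type) (_ : AddCommGroup V) (_ : Module ℂ V) (_ : FiniteDimensional ℂ V)
      (ρ : Representation ℂ G V), ρ.IsIrreducible ∧ ρ (s : G) ≠ 1 ∧
      finrank ℂ V ≤ H.index * finrank ℂ W := by
  classical
  let C := Representation.coind H.subtype σ
  have hC : C (s : G) ≠ 1 := by
    obtain ⟨w, hw⟩ : ∃ w, σ s w ≠ w := by
      by_contra! hc; exact hs (LinearMap.ext hc)
    let f : G → W := fun g => if h : g ∈ H then σ ⟨g, h⟩ w else 0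
    have hf : f ∈ Representation.coindV H.subtype σ := by
      intro a g
      by_cases h : g ∈ H
      · have h' : (a : G) * g ∈ H := H.mul_mem a.2 h
        simp only [f, Subgroup.coe_subtype, h, h', dif_pos]
        rw [← Module.End.mul_apply, ← map_mul]; rfl
      · have h' : (a : G) * g ∉ H := fun h2 => h ((H.mul_mem_cancel_left a.2).1 h2)
        simp [f, h, h']
    intro he
    have h1 := congrArg (fun F => (F ⟨f, hf⟩ : Representation.coindV H.subtype σ).1 1) he
    have h2 : f (1 * (s : G)) = f 1 := h1
    apply hw
    have e1 : f (1 * (s : G)) = σ s w := by simp [f]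
    have e2 : f 1 = w := by
      have : σ ⟨1, H.one_mem⟩ = 1 := map_one σ
      simp [f, H.one_mem, this]
    rw [← e1, h2, e2]
  obtain ⟨τ, hat, v, hv, hgv⟩ := lemA C s hC
  have hinj : Function.Injective (fun (f : Representation.coindV H.subtype σ)
      (q : Quotient (QuotientGroup.rightRel H)) => f.1 q.out) := by
    intro f f' he
    apply Subtype.ext
    funext g
    have h1 := congrFun he (Quotient.mk _ g)
    have h2 : (QuotientGroup.rightRel H) (Quotient.mk (QuotientGroup.rightRel H) g).out g :=
      Quotient.mk_out g
    have h3 := QuotientGroup.rightRel_apply.1 h2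
    have h4 := f.2 ⟨_, h3⟩ (Quotient.mk (QuotientGroup.rightRel H) g).out
    have h5 := f'.2 ⟨_, h3⟩ (Quotient.mk (QuotientGroup.rightRel H) g).out
    simp only [Subgroup.coe_subtype, inv_mul_cancel_right] at h4 h5
    rw [h4, h5]
    exact congrArg _ h1
  let Φ : Representation.coindV H.subtype σ →ₗ[ℂ] (Quotient (QuotientGroup.rightRel H) → W) :=
    { toFun := fun f q => f.1 q.out, map_add' := fun _ _ => rfl, map_smul' := fun _ _ => rfl }
  have hfr : finrank ℂ τ.toSubmodule ≤ H.index * finrank ℂ W := by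
    have h1 := LinearMap.finrank_le_finrank_of_injective (f := Φ) hinj
    have h2 := Submodule.finrank_le τ.toSubmodule
    refine h2.trans (h1.trans ?_)
    rw [Module.finrank_pi_fintype, Finset.sum_const, Finset.card_univ, smul_eq_mul,
      ← Nat.card_eq_fintype_card, Nat.card_congr (QuotientGroup.quotientRightRelEquivQuotientLeftRel H)]
    rfl
  refine ⟨τ.toSubmodule, inferInstance, inferInstance, inferInstance, τ.toRepresentation,
    lemAtom C τ hat, ?_, hfr⟩
  intro he
  have := congrArg (fun f => ((f ⟨v, hv⟩ : τ.toSubmodule) : Representation.coindV H.subtype σ)) he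
  exact hgv this

/-- packaged consequence of the hypothesis -/
theorem lemH (G : Type) [Group G] [Fintype G]
    (h : ∀ V : FDRep ℂ G, Simple V → 1 < finrank ℂ V →
      (Fintype.card G : ℝ) / (Nat.card {g : G // V.character g = V.character 1}) /
        (finrank ℂ V) ≤ (finrank ℂ V : ℝ) ^ 2)
    {V : Type} [AddCommGroup V] [Module ℂ V]
    [FiniteDimensional ℂ V] (ρ : Representation ℂ G V) (hρ : ρ.IsIrreducible)
    (hd : 1 < finrank ℂ V) : Nat.card G ≤ Nat.card ρ.ker * finrank ℂ V ^ 3 := by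
  have h1 := h (FDRep.of ρ) (lemB ρ hρ) hd
  have h2 : Nat.card {g : G // (FDRep.of ρ).character g = (FDRep.of ρ).character 1} =
      Nat.card ρ.ker := by
    apply Nat.card_congr
    refine Equiv.subtypeEquivRight fun g => ?_
    rw [MonoidHom.mem_ker]
    constructor
    · intro he
      refine lemD (ρ g) (Nat.card G) Nat.card_pos (by rw [← map_pow, pow_card_eq_one', map_one]) ?_
      rw [FDRep.char_one] at he
      exact he
    · intro he
      have : (FDRep.of ρ).ρ g = (FDRep.of ρ).ρ 1 := by
        simp only [FDRep.of_ρ', map_one]; exact he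
      simp only [FDRep.character, this]
  rw [h2] at h1
  change (Fintype.card G : ℝ) / (Nat.card ρ.ker) / (finrank ℂ V) ≤ (finrank ℂ V : ℝ) ^ 2 at h1
  have hk : (0 : ℝ) < Nat.card ρ.ker := by exact_mod_cast Nat.card_pos
  have hd0 : (0 : ℝ) < finrank ℂ V := by exact_mod_cast (by omega : 0 < finrank ℂ V)
  rw [div_le_iff₀ hd0, div_le_iff₀ hk] at h1
  rw [Nat.card_eq_fintype_card (α := G)]
  have : (Fintype.card G : ℝ) ≤ Nat.card ρ.ker * (finrank ℂ V : ℝ) ^ 3 := by linarith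
  exact_mod_cast this

/-- `T` is stable under conjugation by `N`. -/
def NInv {G : Type} [Group G] (N T : Subgroup G) : Prop :=
  ∀ n ∈ N, ∀ x ∈ T, n * x * n⁻¹ ∈ T

/-- conjugate subgroup -/
def cj {G : Type} [Group G] (g : G) (S : Subgroup G) : Subgroup G :=
  S.map (MulAut.conj g).toMonoidHom

theorem mem_cj {G : Type} [Group G] (g x : G) (S : Subgroup G) :
    x ∈ cj g S ↔ g⁻¹ * x * g ∈ S := by
  unfold cj
  rw [Subgroup.mem_map]
  constructor
  · rintro ⟨y, hy, rfl⟩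
    simpa [mul_assoc] using hy
  · intro h
    exact ⟨_, h, by simp [mul_assoc]⟩

/-- minimal `N`-invariant -/
structure MinN {G : Type} [Group G] (N S : Subgroup G) : Prop where
  ne : S ≠ ⊥
  le : S ≤ N
  inv : NInv N S
  min : ∀ T, T ≤ S → NInv N T → T ≠ ⊥ → T = S

theorem exists_minN {G : Type} [Group G] [Finite G] (N : Subgroup G) (hbot : N ≠ ⊥) :
    ∃ S, MinN N S := by
  have hfin : {T : Subgroup G | T ≠ ⊥ ∧ T ≤ N ∧ NInv N T}.Finite := Set.toFinite _
  obtain ⟨S, hS⟩ := hfin.exists_minimal ⟨N, hbot, le_rfl, fun n hn x hx =>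
    N.mul_mem (N.mul_mem hn hx) (N.inv_mem hn)⟩
  refine ⟨S, hS.prop.1, hS.prop.2.1, hS.prop.2.2, fun T hT hi hb => ?_⟩
  exact le_antisymm hT (hS.le_of_le ⟨hb, hT.trans hS.prop.2.1, hi⟩ hT)

theorem MinN.cj {G : Type} [Group G] {N S : Subgroup G} (hn : N.Normal) (h : MinN N S) (g : G) :
    MinN N (cj g S) := by
  have key : ∀ T, NInv N T → ∀ g, NInv N (_root_.cj g T) := by
    intro T hT g n hnN x hx
    rw [mem_cj] at hx ⊢
    have h1 : g⁻¹ * n * g ∈ N := by simpa using hn.conj_mem n hnN g⁻¹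
    have := hT _ h1 _ hx
    simpa [mul_assoc] using this
  have hinv : ∀ T : Subgroup G, ∀ g, _root_.cj g (_root_.cj g⁻¹ T) = T := by
    intro T g; ext x; rw [mem_cj, mem_cj]; simp [mul_assoc]
  have hb : ∀ g, _root_.cj g (⊥ : Subgroup G) = ⊥ := fun g => Subgroup.map_bot _
  refine ⟨fun he => h.ne ?_, fun x hx => ?_, key S h.inv g, fun T hT hi hbt => ?_⟩
  · have := hinv S g⁻¹
    rw [inv_inv, he, hb] at this
    exact this.symm
  · rw [mem_cj] at hx
    have := hn.conj_mem _ (h.le hx) g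
    simpa [mul_assoc] using this
  · have h1 : _root_.cj g⁻¹ T = S := by
      refine h.min _ (fun x hx => ?_) (key T hi g⁻¹) (fun he => hbt ?_)
      · rw [mem_cj, inv_inv] at hx
        have := hT hx
        rw [mem_cj] at this
        simpa [mul_assoc] using this
      · rw [← hinv T g, he, hb]
    rw [← h1, hinv]

theorem MinN.commute {G : Type} [Group G] {N S T : Subgroup G} (hS : MinN N S) (hT : MinN N T)
    (hne : S ≠ T) : ∀ x y, x ∈ S → y ∈ T → Commute x y := by
  have hinf : S ⊓ T = ⊥ := by
    by_contra hb
    have hi : NInv N (S ⊓ T) := fun n hn x hx => ⟨hS.inv n hn x hx.1, hT.inv n hn x hx.2⟩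
    have h1 := hS.min _ inf_le_left hi hb
    have h2 := hT.min _ inf_le_right hi hb
    exact hne (h1.symm.trans h2)
  intro x y hx hy
  have h1 : x * y * x⁻¹ * y⁻¹ ∈ S ⊓ T := by
    constructor
    · have := S.mul_mem hx (hS.inv y (hT.le hy) _ (S.inv_mem hx))
      simpa [mul_assoc] using this
    · exact T.mul_mem (hT.inv x (hS.le hx) y hy) (T.inv_mem hy)
  rw [hinf, Subgroup.mem_bot] at h1
  exact mul_inv_eq_iff_eq_mul.1 (mul_inv_eq_one.1 h1)

set_option linter.unusedSectionVars false

section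
variable {G : Type} [Group G] [Fintype G]
    (N : Subgroup G) (hn : N.Normal)
    (hmin : ∀ M : Subgroup G, M.Normal → M ≤ N → M ≠ ⊥ → M = N)
    (hns : ¬ Group.IsSolvable N)
include hn hmin hns

theorem nonab : ¬ ∀ x ∈ N, ∀ y ∈ N, x * y = y * x := by
  intro h
  exact hns (Group.isSolvable_of_comm fun a b => Subtype.ext (h a a.2 b b.2))

theorem center_bot (x : G) (hx : x ∈ N) (hc : ∀ y ∈ N, x * y = y * x) : x = 1 := by
  let M : Subgroup G := N ⊓ Subgroup.centralizer (N : Set G)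
  have hM : M.Normal := by
    have := hn
    infer_instance
  by_contra hne
  have hxM : x ∈ M := ⟨hx, Subgroup.mem_centralizer_iff.2 fun y hy => (hc y hy).symm⟩
  have := hmin M hM inf_le_left (fun hb => hne (by rw [hb] at hxM; exact hxM))
  refine nonab N hn hmin hns fun a ha b hb => ?_
  rw [← this] at ha
  exact (Subgroup.mem_centralizer_iff.1 ha.2 b hb).symm

theorem simple_of (h : MinN N N) : IsSimpleGroup N := by
  have : Nontrivial N := (Subgroup.nontrivial_iff_ne_bot N).2 h.ne
  refine { eq_bot_or_eq_top_of_normal := fun M hM => ?_ }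
  by_cases hb : M.map N.subtype = ⊥
  · left; exact (Subgroup.map_eq_bot_iff_of_injective _ N.subtype_injective).1 hb
  · right
    have := h.min (M.map N.subtype) (Subgroup.map_subtype_le M) (by
      rintro n hnN _ ⟨y, hy, rfl⟩
      exact ⟨⟨n, hnN⟩ * y * ⟨n, hnN⟩⁻¹, hM.conj_mem y hy _, rfl⟩) hb
    apply Subgroup.map_injective N.subtype_injective
    rw [this]
    ext x; simp

variable (S : Subgroup G) (hS : MinN N S) (hSN : S ≠ N)
include hS

theorem iSup_cj : ⨆ q : G ⧸ Subgroup.normalizer (S : Set G), cj q.out S = N := by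
  have hall : ∀ g, cj g S ≤ ⨆ q : G ⧸ Subgroup.normalizer (S : Set G), cj q.out S := by
    intro g
    refine le_trans (le_of_eq ?_) (le_iSup _ (QuotientGroup.mk g))
    obtain ⟨h, hh⟩ := QuotientGroup.mk_out_eq_mul (Subgroup.normalizer (S : Set G)) g
    rw [hh]
    ext x
    rw [mem_cj, mem_cj]
    have := (Subgroup.mem_normalizer_iff''.1 h.2) (g⁻¹ * x * g)
    rw [this]; simp [mul_assoc]
  apply hmin
  · constructor
    intro x hx g
    have : ∀ y ∈ ⨆ q : G ⧸ Subgroup.normalizer (S : Set G), cj q.out S,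
        y ∈ (⨆ q : G ⧸ Subgroup.normalizer (S : Set G), cj q.out S).comap
          (MulAut.conj g).toMonoidHom := by
      rw [← SetLike.le_def]
      refine iSup_le fun q => ?_
      intro y hy
      refine hall (g * q.out) ?_
      rw [mem_cj] at hy ⊢
      simpa [mul_assoc] using hy
    exact this x hx
  · exact iSup_le fun q => (hS.cj hn _).le
  · intro hb
    have h1 := hall 1
    rw [hb, le_bot_iff] at h1
    exact (hS.cj hn 1).ne h1

omit hmin hns in
theorem cj_comm (q r : G ⧸ Subgroup.normalizer (S : Set G)) (hqr : q ≠ r) :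
    ∀ x y, x ∈ cj q.out S → y ∈ cj r.out S → Commute x y := by
  refine (hS.cj hn _).commute (hS.cj hn _) ?_
  intro he
  apply hqr
  rw [← q.out_eq, ← r.out_eq]
  refine QuotientGroup.eq.2 ?_
  rw [Subgroup.mem_normalizer_iff'']
  intro h
  have := SetLike.ext_iff.1 he (q.out * h * q.out⁻¹)
  rw [mem_cj, mem_cj] at this
  simpa [mul_assoc] using this

theorem cj_indep : iSupIndep fun q : G ⧸ Subgroup.normalizer (S : Set G) => cj q.out S := by
  intro q
  rw [Subgroup.disjoint_def]
  intro x hx hx'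
  have hxN := (hS.cj hn _).le hx
  refine center_bot N hn hmin hns x hxN ?_
  have h1 : ∀ r : G ⧸ Subgroup.normalizer (S : Set G), cj r.out S ≤ Subgroup.centralizer {x} := by
    intro r y hy
    rw [Subgroup.mem_centralizer_singleton_iff]
    by_cases hr : q = r
    · subst hr
      have h2 : (⨆ j : G ⧸ Subgroup.normalizer (S : Set G), ⨆ (_ : j ≠ q), cj j.out S) ≤ Subgroup.centralizer {y} := by
        refine iSup_le fun j => iSup_le fun hj => ?_
        intro z hz
        rw [Subgroup.mem_centralizer_singleton_iff]
        exact (cj_comm N hn S hS _ _ hj z y hz hy).eq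
      have := Subgroup.mem_centralizer_singleton_iff.1 (h2 hx')
      exact this.symm
    · exact (cj_comm N hn S hS _ _ hr x y hx hy).eq.symm
  have h2 : N ≤ Subgroup.centralizer {x} := by
    rw [← iSup_cj N hn hmin hns S hS]
    exact iSup_le h1
  intro y hy
  exact (Subgroup.mem_centralizer_singleton_iff.1 (h2 hy)).symm

omit hn hmin hns hS in
theorem cj_one_out : cj (QuotientGroup.mk (s := Subgroup.normalizer (S : Set G)) 1).out S = S := by
  obtain ⟨h, hh⟩ := QuotientGroup.mk_out_eq_mul (Subgroup.normalizer (S : Set G)) 1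
  rw [hh, one_mul]
  ext x
  rw [mem_cj]
  exact (Subgroup.mem_normalizer_iff''.1 h.2 x).symm

theorem S_nonsolvable : ¬ Group.IsSolvable S := by
  intro hsol
  have hab : ∀ x ∈ S, ∀ y ∈ S, x * y = y * x := by
    have hcomm : ⁅S, S⁆ = ⊥ := by
      by_contra hb
      have h1 := hS.min ⁅S, S⁆ (Subgroup.commutator_le.2 fun a ha b hb =>
        S.mul_mem (S.mul_mem (S.mul_mem ha hb) (S.inv_mem ha)) (S.inv_mem hb)) ?_ hb
      · have : commutator S = ⊤ := by
          apply Subgroup.map_injective S.subtype_injective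
          rw [commutator_def, Subgroup.map_commutator]
          simpa [← MonoidHom.range_eq_map] using h1
        have hnt : Nontrivial S := (Subgroup.nontrivial_iff_ne_bot S).2 hS.ne
        exact (Group.IsSolvable.commutator_lt_top_of_nontrivial S).ne this
      · intro n hnN x hx
        have : ⁅S, S⁆ ≤ ⁅S, S⁆.comap (MulAut.conj n).toMonoidHom := by
          rw [Subgroup.commutator_le]
          intro a ha b hb
          rw [Subgroup.mem_comap, map_commutatorElement]
          exact Subgroup.commutator_mem_commutator (hS.inv n hnN a ha) (hS.inv n hnN b hb)
        exact this hx
    intro x hx y hy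
    have := Subgroup.commutator_mem_commutator hx hy
    rw [hcomm, Subgroup.mem_bot, commutatorElement_eq_one_iff_mul_comm] at this
    exact this
  apply hS.ne
  rw [Subgroup.eq_bot_iff_forall]
  intro x hx
  refine center_bot N hn hmin hns x (hS.le hx) ?_
  have h2 : N ≤ Subgroup.centralizer {x} := by
    rw [← iSup_cj N hn hmin hns S hS]
    refine iSup_le fun r y hy => ?_
    rw [Subgroup.mem_centralizer_singleton_iff]
    by_cases hr : QuotientGroup.mk 1 = r
    · subst hr
      rw [cj_one_out] at hy
      exact hab y hy x hx
    · exact (cj_comm N hn S hS _ _ hr x y (by rwa [cj_one_out]) hy).eq.symm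
  intro y hy
  exact (Subgroup.mem_centralizer_singleton_iff.1 (h2 hy)).symm

include hSN in
theorem two_le_index : 2 ≤ (Subgroup.normalizer (S : Set G)).index := by
  have h0 : (Subgroup.normalizer (S : Set G)).index ≠ 0 := Subgroup.index_ne_zero_of_finite
  have h1 : (Subgroup.normalizer (S : Set G)).index ≠ 1 := by
    intro h
    rw [Subgroup.index_eq_one] at h
    exact hSN (hmin S (Subgroup.normalizer_eq_top_iff.1 h) hS.le hS.ne)
  omega

theorem card_bound (Z : Subgroup G) (hZ : Z.Normal) (hZN : Z ⊓ N = ⊥) :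
    Nat.card S ^ ((Subgroup.normalizer (S : Set G)).index - 1) * Nat.card Z ≤
      Nat.card (Subgroup.centralizer (S : Set G)) := by
  classical
  let q0 : G ⧸ Subgroup.normalizer (S : Set G) := QuotientGroup.mk 1
  let ι := {q : G ⧸ Subgroup.normalizer (S : Set G) // q ≠ q0}
  have hcomm : Pairwise fun i j : ι => ∀ x y : G, x ∈ cj i.1.out S → y ∈ cj j.1.out S →
      Commute x y := by
    intro i j hij
    exact cj_comm N hn S hS _ _ (fun h => hij (Subtype.ext h))
  let φ := Subgroup.noncommPiCoprod hcomm
  have hφ : Function.Injective φ :=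
    Subgroup.injective_noncommPiCoprod_of_iSupIndep
      ((cj_indep N hn hmin hns S hS).comp Subtype.val_injective)
  have hr : φ.range = ⨆ i : ι, cj i.1.out S := Subgroup.noncommPiCoprod_range
  have hrK : φ.range ≤ Subgroup.centralizer (S : Set G) := by
    rw [hr]
    refine iSup_le fun i x hx => Subgroup.mem_centralizer_iff.2 fun y hy => ?_
    exact (cj_comm N hn S hS q0 i.1 i.2.symm y x (by
      show y ∈ cj (QuotientGroup.mk 1 : G ⧸ Subgroup.normalizer (S : Set G)).out S
      rw [cj_one_out]; exact hy) hx).eq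
  have hrN : φ.range ≤ N := by
    rw [hr]; exact iSup_le fun i => (hS.cj hn _).le
  have hZK : Z ≤ Subgroup.centralizer (S : Set G) := by
    intro z hz
    refine Subgroup.mem_centralizer_iff.2 fun y hy => ?_
    have hyN := hS.le hy
    have : y * z * y⁻¹ * z⁻¹ ∈ Z ⊓ N := by
      refine ⟨Z.mul_mem (hZ.conj_mem z hz y) (Z.inv_mem hz), ?_⟩
      have := N.mul_mem hyN (hn.conj_mem _ (N.inv_mem hyN) z)
      simpa [mul_assoc] using this
    rw [hZN, Subgroup.mem_bot] at this
    exact mul_inv_eq_iff_eq_mul.1 (mul_inv_eq_one.1 this)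
  have hcS : ∀ g, Nat.card (cj g S) = Nat.card S := fun g =>
    Subgroup.card_map_of_injective (MulAut.conj g).injective
  have hpi : Nat.card (∀ i : ι, cj i.1.out S) =
      Nat.card S ^ ((Subgroup.normalizer (S : Set G)).index - 1) := by
    rw [Nat.card_pi]
    simp only [hcS, Finset.prod_const, Finset.card_univ]
    congr 1
    rw [Subgroup.index, Nat.card_eq_fintype_card]
    exact Set.card_ne_eq q0
  rw [← hpi, ← Nat.card_prod]
  refine Nat.card_le_card_of_injective (fun p : (∀ i : ι, cj i.1.out S) × Z =>
    (⟨φ p.1 * p.2, Subgroup.mul_mem _ (hrK ⟨_, rfl⟩) (hZK p.2.2)⟩ :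
      Subgroup.centralizer (S : Set G))) ?_
  rintro ⟨a, z⟩ ⟨b, w⟩ he
  have he' : φ a * z = φ b * w := congrArg Subtype.val he
  have h1 : (φ b)⁻¹ * φ a = w * (z : G)⁻¹ := by
    rw [inv_mul_eq_iff_eq_mul, ← mul_assoc, ← he', mul_inv_cancel_right]
  have h2 : (w : G) * (z : G)⁻¹ ∈ Z ⊓ N := by
    refine ⟨Z.mul_mem w.2 (Z.inv_mem z.2), ?_⟩
    rw [← h1]
    exact N.mul_mem (N.inv_mem (hrN ⟨_, rfl⟩)) (hrN ⟨_, rfl⟩)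
  rw [hZN, Subgroup.mem_bot] at h2
  have h3 : w = z := Subtype.ext (mul_inv_eq_one.1 h2)
  rw [h2] at h1
  have h4 : a = b := hφ (inv_mul_eq_one.1 h1).symm
  rw [h3, h4]

theorem exists_sylow : ∃ (p : ℕ) (_ : Fact p.Prime) (P : Sylow p S), 4 ≤ Nat.card P := by
  by_contra! hc
  refine S_nonsolvable N hn hmin hns S hS ?_
  have : IsZGroup S := ⟨fun p hp P => ?_⟩
  · infer_instance
  · have hF : Fact p.Prime := ⟨hp⟩
    have h1 := hc p hF P
    have h2 : 0 < Nat.card P := Nat.card_pos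
    interval_cases hcP : Nat.card P
    · have : Subsingleton P := (Nat.card_eq_one_iff_unique.1 hcP).1
      infer_instance
    · have : Fact (Nat.Prime 2) := ⟨Nat.prime_two⟩
      exact isCyclic_of_prime_card hcP
    · have : Fact (Nat.Prime 3) := ⟨Nat.prime_three⟩
      exact isCyclic_of_prime_card hcP

theorem sylow_not_normal {p : ℕ} [Fact p.Prime] (P : Sylow p S) (h4 : 4 ≤ Nat.card P) :
    ¬ (P : Subgroup S).Normal := by
  intro hP
  have hch := P.characteristic_of_normal hP
  have hnorm : NInv N ((P : Subgroup S).map S.subtype) := by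
    rintro n hnN _ ⟨y, hy, rfl⟩
    have hnS : n ∈ Subgroup.normalizer (S : Set G) := by
      rw [Subgroup.mem_normalizer_iff]
      intro h
      refine ⟨hS.inv n hnN h, fun h' => ?_⟩
      have := hS.inv n⁻¹ (N.inv_mem hnN) _ h'
      simpa [mul_assoc] using this
    let e : MulAut S := S.normalizerMonoidHom ⟨n, hnS⟩
    have h1 := Subgroup.characteristic_iff_map_eq.1 hch e
    have h2 : e y ∈ (P : Subgroup S) := by
      rw [← h1]; exact ⟨y, hy, rfl⟩
    exact ⟨e y, h2, rfl⟩
  have hb : (P : Subgroup S).map S.subtype ≠ ⊥ := by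
    intro hb
    have := (Subgroup.map_eq_bot_iff_of_injective _ S.subtype_injective).1 hb
    have h5 : Nat.card P = 1 := by
      rw [show Nat.card P = Nat.card (P : Subgroup S) from rfl, this]; simp
    omega
  have h1 := hS.min _ (Subgroup.map_subtype_le _) hnorm hb
  have htop : (P : Subgroup S) = ⊤ := by
    apply Subgroup.map_injective S.subtype_injective
    rw [h1]; ext x; simp
  have hpg : IsPGroup p S := by
    have := P.isPGroup'
    rw [htop] at this
    exact this.of_equiv Subgroup.topEquiv
  have := hpg.isNilpotent
  exact S_nonsolvable N hn hmin hns S hS inferInstance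

end

theorem arith (n s d k z hc v g : ℕ) (hn : 2 ≤ n) (hs : 4 * d < s) (hs4 : 4 ≤ s) (hd0 : 0 < d)
    (hz : 0 < z)
    (h1 : g ≤ z * v ^ 3) (h2 : v ≤ n * d) (h3 : n * hc = g) (h4 : d ^ 2 * k ≤ hc)
    (h5 : s ^ (n - 1) * z ≤ k) : False := by
  have a1 : n * (d ^ 2 * (s ^ (n - 1) * z)) ≤ z * (n * d) ^ 3 := by
    calc n * (d ^ 2 * (s ^ (n - 1) * z)) ≤ n * (d ^ 2 * k) := by gcongr
      _ ≤ n * hc := by gcongr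
      _ = g := h3
      _ ≤ z * v ^ 3 := h1
      _ ≤ _ := by gcongr
  have a2 : s ^ (n - 1) ≤ n ^ 2 * d := by
    have : (n * d ^ 2 * z) * s ^ (n - 1) ≤ (n * d ^ 2 * z) * (n ^ 2 * d) := by
      calc _ = n * (d ^ 2 * (s ^ (n - 1) * z)) := by ring
        _ ≤ _ := a1
        _ = _ := by ring
    exact Nat.le_of_mul_le_mul_left this (by positivity)
  obtain ⟨m, rfl⟩ : ∃ m, n = m + 2 := ⟨n - 2, by omega⟩
  have a3 : s ^ (m + 1) ≤ (m + 2) ^ 2 * d := a2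
  have a4 : (m + 2) ^ 2 ≤ 4 * 4 ^ m := by
    clear * -
    induction m with
    | zero => norm_num
    | succ m ih =>
      have h1 : (m + 1 + 2) ^ 2 ≤ 4 * (m + 2) ^ 2 := by
        calc (m + 1 + 2) ^ 2 ≤ (2 * (m + 2)) ^ 2 := Nat.pow_le_pow_left (by omega) 2
          _ = 4 * (m + 2) ^ 2 := by ring
      calc (m + 1 + 2) ^ 2 ≤ 4 * (m + 2) ^ 2 := h1
        _ ≤ 4 * (4 * 4 ^ m) := Nat.mul_le_mul_left 4 ih
        _ = 4 * 4 ^ (m + 1) := by ring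
  have a5 : 4 ^ m ≤ s ^ m := Nat.pow_le_pow_left hs4 m
  have a6 : 4 * s ^ (m + 1) < 4 * s ^ (m + 1) := by
    calc 4 * s ^ (m + 1) ≤ 4 * ((m + 2) ^ 2 * d) := by gcongr
      _ = (m + 2) ^ 2 * (4 * d) := by ring
      _ < (m + 2) ^ 2 * s := by gcongr
      _ ≤ (4 * s ^ m) * s := by gcongr; omega
      _ = 4 * s ^ (m + 1) := by ring
  exact lt_irrefl _ a6

theorem main_aux (G : Type) [Group G] [Fintype G]
    (N : Subgroup G) (hn : N.Normal)
    (hmin : ∀ M : Subgroup G, M.Normal → M ≤ N → M ≠ ⊥ → M = N)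
    (hns : ¬ Group.IsSolvable N)
    (h : ∀ V : FDRep ℂ G, Simple V → 1 < finrank ℂ V →
      (Fintype.card G : ℝ) / (Nat.card {g : G // V.character g = V.character 1}) /
        (finrank ℂ V) ≤ (finrank ℂ V : ℝ) ^ 2)
    (S : Subgroup G) (hS : MinN N S) (hSN : S ≠ N) : False := by
  classical
  obtain ⟨p, hp, P, hP4⟩ := exists_sylow N hn hmin hns S hS
  have hPn := sylow_not_normal N hn hmin hns S hS P hP4
  let H := Subgroup.normalizer (S : Set G)
  let act : MulAction H (Sylow p S) := MulAction.compHom _ S.normalizerMonoidHom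
  have hact : ∀ (a : H) (Q : Sylow p S), a • Q = S.normalizerMonoidHom a • Q := fun _ _ => rfl
  have hSH : S ≤ H := Subgroup.le_normalizer
  obtain ⟨s, hs⟩ : ∃ s : S, s • P ≠ P := by
    by_contra! hc
    apply hPn
    rw [← Subgroup.normalizer_eq_top_iff, eq_top_iff]
    intro s _
    exact Sylow.smul_eq_iff_mem_normalizer.1 (hc s)
  let s' : H := ⟨s, hSH s.2⟩
  have hs' : s' • P ≠ P := by
    have : S.normalizerMonoidHom s' = MulAut.conj s := by
      ext x; rfl
    rw [hact, this]; exact hs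
  have : Fintype (Sylow p S) := Fintype.ofFinite _
  obtain ⟨W, _, _, _, σ, hσ, hσs, hdW, hker⟩ := lemE s' P hs'
  obtain ⟨V, _, _, _, ρ, hρ, hρs, hdV⟩ := lemF H σ s' hσs
  have hsN : (s : G) ∈ N := hS.le s.2
  -- kernel
  have hZN : ρ.ker ⊓ N = ⊥ := by
    by_contra hb
    have := hmin (ρ.ker ⊓ N) inferInstance inf_le_right hb
    have h1 : (s : G) ∈ ρ.ker ⊓ N := by rw [this]; exact hsN
    exact hρs h1.1
  have hd1 : 1 < finrank ℂ V := by
    by_contra hle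
    have hcommV : ∀ a b : G, ρ a * ρ b = ρ b * ρ a := by
      have hle' : finrank ℂ V ≤ 1 := by omega
      obtain ⟨v, hv⟩ := finrank_le_one_iff.1 hle'
      intro a b
      ext x
      obtain ⟨ca, hca⟩ := hv (ρ a v)
      obtain ⟨cb, hcb⟩ := hv (ρ b v)
      obtain ⟨c, rfl⟩ := hv x
      simp only [Module.End.mul_apply, map_smul, ← hca, ← hcb]
      rw [smul_comm cb ca v]
    refine nonab N hn hmin hns fun x hx y hy => ?_
    have : x * y * x⁻¹ * y⁻¹ ∈ ρ.ker ⊓ N := by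
      refine ⟨?_, N.mul_mem (N.mul_mem (N.mul_mem hx hy) (N.inv_mem hx)) (N.inv_mem hy)⟩
      change ρ (x * y * x⁻¹ * y⁻¹) = 1
      have hxy : ρ (x * y) = ρ (y * x) := by rw [map_mul, map_mul, hcommV]
      rw [mul_assoc, map_mul, hxy, ← map_mul]
      simp [mul_assoc]
    rw [hZN, Subgroup.mem_bot] at this
    exact mul_inv_eq_iff_eq_mul.1 (mul_inv_eq_one.1 this)
  have e1 := lemH G h ρ hρ hd1
  have e5 := card_bound N hn hmin hns S hS ρ.ker inferInstance hZN
  have e2 := two_le_index N hn hmin hns S hS hSN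
  let K := Subgroup.centralizer (S : Set G)
  have hKH : K ≤ H := Subgroup.centralizer_le_normalizer _
  have e4 := lemC σ hσ (K.subgroupOf H) (by
    intro k hk
    apply hker
    intro Q
    have : S.normalizerMonoidHom k = 1 := by
      ext x
      have h1 := Subgroup.mem_centralizer_iff.1 (Subgroup.mem_subgroupOf.1 hk) x x.2
      change (k : G) * x * (k : G)⁻¹ = x
      rw [← h1, mul_inv_cancel_right]
    rw [hact, this, one_smul])
  rw [Nat.card_congr (Subgroup.subgroupOfEquivOfLe hKH).toEquiv] at e4
  have hcard : Fintype.card (Sylow p S) * 4 ≤ Nat.card S := by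
    have h1 := Nat.le_of_dvd (Nat.pos_of_ne_zero Subgroup.index_ne_zero_of_finite) P.card_dvd_index
    rw [Nat.card_eq_fintype_card] at h1
    rw [← (P : Subgroup S).index_mul_card]
    exact Nat.mul_le_mul h1 hP4
  have hPS : Nat.card P ≤ Nat.card S := Subgroup.card_le_card_group _
  have hd0 : 0 < finrank ℂ W := by
    rw [Nat.pos_iff_ne_zero]
    intro h0
    rw [h0] at hdV; omega
  exact arith H.index (Nat.card S) (finrank ℂ W) (Nat.card K) (Nat.card ρ.ker) (Nat.card H)
    (finrank ℂ V) (Nat.card G) e2 (by omega) (by omega) hd0 Nat.card_pos e1 hdV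
    H.index_mul_card e4 e5


/-- Let `G` be a finite group and `N` a minimal normal subgroup of `G` (a nontrivial
normal subgroup containing no nontrivial normal subgroup of `G` properly inside it) which
is not solvable.  Suppose `cod(χ) ≤ χ(1)^2` for every nonlinear irreducible complex
character `χ` of `G`.  Then `N` is a nonabelian simple group. -/
theorem minimal_normal_nonsolvable_is_simple (G : Type) [Group G] [Fintype G]
    (N : Subgroup G) (hn : N.Normal) (hbot : N ≠ ⊥)
    (hmin : ∀ M : Subgroup G, M.Normal → M ≤ N → M ≠ ⊥ → M = N)
    (hns : ¬ IsSolvable N)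
    (h : ∀ V : FDRep ℂ G, Simple V → 1 < finrank ℂ V →
      (Fintype.card G : ℝ) / (Nat.card {g : G // V.character g = V.character 1}) /
        (finrank ℂ V) ≤ (finrank ℂ V : ℝ) ^ 2) :
    IsSimpleGroup N ∧ ¬ ∀ a b : N, a * b = b * a := by
  obtain ⟨S, hS⟩ := exists_minN N hbot
  have hns' : ¬ Group.IsSolvable N := hns
  refine ⟨?_, fun hc => nonab N hn hmin hns' fun x hx y hy =>
    congrArg Subtype.val (hc ⟨x, hx⟩ ⟨y, hy⟩)⟩
  by_cases hSN : S = N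
  · subst hSN
    exact simple_of S hn hmin hns' hS
  · exact (main_aux G N hn hmin hns' h S hS hSN).elim
end

section
/- For every integer n ≥ 5 and every real number k > 5/2, the alternating group A_n (the alternating group on n letters) has an irreducible complex character θ with θ(1) > 1 such that k·|A_n| > θ(1)^3. -/
open CategoryTheory Module

namespace AltSmall

/-- permutation representation -/
noncomputable def perm (n : ℕ) : Representation ℂ (alternatingGroup (Fin n)) (Fin n → ℂ) where
  toFun g := LinearMap.funLeft ℂ ℂ (fun i => (g : Equiv.Perm (Fin n))⁻¹ i)
  map_one' := by ext; simp [LinearMap.funLeft]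
  map_mul' x y := by
    apply LinearMap.ext
    intro f
    funext i
    simp [LinearMap.funLeft, mul_inv_rev]

lemma perm_apply (n : ℕ) (g : alternatingGroup (Fin n)) (f : Fin n → ℂ) (i : Fin n) :
    perm n g f i = f ((g : Equiv.Perm (Fin n))⁻¹ i) := rfl

/-- sum-zero vectors -/
noncomputable def sz (n : ℕ) : Submodule ℂ (Fin n → ℂ) :=
  LinearMap.ker (∑ i, LinearMap.proj (R := ℂ) (φ := fun _ : Fin n => ℂ) i)

lemma mem_sz (n : ℕ) (f : Fin n → ℂ) : f ∈ sz n ↔ ∑ i, f i = 0 := by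
  simp [sz, LinearMap.mem_ker, LinearMap.sum_apply]

lemma exists_irr (n : ℕ) (hn : 5 ≤ n) : ∃ σ : Subrepresentation (perm n),
    σ.toSubmodule ≠ ⊥ ∧ σ.toSubmodule ≤ sz n ∧ σ.toRepresentation.IsIrreducible := by
  let S : Set (Submodule ℂ (Fin n → ℂ)) :=
    {U | U ≠ ⊥ ∧ U ≤ sz n ∧ ∀ g, ∀ v ∈ U, perm n g v ∈ U}
  have hS : sz n ∈ S := by
    refine ⟨?_, le_rfl, ?_⟩
    · rw [Submodule.ne_bot_iff]
      refine ⟨Pi.single ⟨0, by omega⟩ 1 - Pi.single ⟨1, by omega⟩ 1, ?_, ?_⟩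
      · rw [mem_sz]; simp
      · intro h
        have := congrFun h ⟨0, by omega⟩
        simp at this
    · intro g v hv
      rw [mem_sz] at *
      rw [← hv]
      exact Equiv.sum_comp ((g : Equiv.Perm (Fin n))⁻¹) v
  obtain ⟨U, ⟨hU0, hUs, hUg⟩, hmin⟩ := WellFounded.has_min
    (wellFounded_lt (α := Submodule ℂ (Fin n → ℂ))) S ⟨_, hS⟩
  refine ⟨⟨U, fun g v hv => hUg g v hv⟩, hU0, hUs, ?_⟩
  set σ : Subrepresentation (perm n) := ⟨U, fun g v hv => hUg g v hv⟩ with hσ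
  have hnt : Nontrivial (Subrepresentation σ.toRepresentation) := by
    refine ⟨⊥, ⊤, fun h => hU0 ?_⟩
    have h2 : (⊥ : Submodule ℂ σ.toSubmodule) = ⊤ := congrArg Subrepresentation.toSubmodule h
    rw [Submodule.eq_bot_iff]
    intro x hx
    have : (⟨x, hx⟩ : σ.toSubmodule) ∈ (⊥ : Submodule ℂ σ.toSubmodule) := by rw [h2]; trivial
    simpa using this
  refine { eq_bot_or_eq_top := fun τ => ?_ }
  by_cases h0 : τ.toSubmodule = ⊥
  · left; exact Subrepresentation.toSubmodule_injective h0
  · right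
    apply Subrepresentation.toSubmodule_injective
    have hle : τ.toSubmodule.map σ.toSubmodule.subtype ≤ U := Submodule.map_subtype_le _ _
    have := hmin (τ.toSubmodule.map σ.toSubmodule.subtype) ⟨?_, hle.trans hUs, ?_⟩
    · have heq := eq_of_le_of_not_lt hle this
      change τ.toSubmodule = ⊤
      rw [eq_top_iff]
      rintro ⟨x, hx⟩ -
      have hx' : x ∈ τ.toSubmodule.map σ.toSubmodule.subtype := by rw [heq]; exact hx
      obtain ⟨y, hy, rfl⟩ := hx'
      exact hy
    · intro h
      apply h0
      rw [Submodule.eq_bot_iff]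
      intro x hx
      have hx' : (x : Fin n → ℂ) ∈ τ.toSubmodule.map σ.toSubmodule.subtype := ⟨x, hx, rfl⟩
      rw [h] at hx'
      exact Subtype.ext hx'
    · rintro g _ ⟨y, hy, rfl⟩
      exact ⟨σ.toRepresentation g y, τ.apply_mem_toSubmodule g hy, rfl⟩

lemma simple_of {G V : Type} [Group G] [Fintype G] [AddCommGroup V] [Module ℂ V]
    [FiniteDimensional ℂ V] (ρ : Representation ℂ G V) (h : ρ.IsIrreducible) :
    Simple (FDRep.of ρ) := by
  rw [FDRep.simple_iff_end_is_rank_one]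
  rw [← Representation.IsIrreducible.finrank_intertwiningMap_self ρ]
  refine (LinearEquiv.finrank_eq ?_).symm
  let e : Representation.IntertwiningMap ρ ρ ≃ₗ[ℂ]
      ((forget₂ (FDRep ℂ G) (Rep ℂ G)).obj (FDRep.of ρ) ⟶
        (forget₂ (FDRep ℂ G) (Rep ℂ G)).obj (FDRep.of ρ)) :=
    { toFun := fun f => Rep.ofHom f
      invFun := fun f => f.hom
      map_add' := fun _ _ => rfl
      map_smul' := fun _ _ => rfl
      left_inv := fun _ => rfl
      right_inv := fun _ => rfl }
  exact e.trans (FDRep.forget₂HomLinearEquiv _ _)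

/-- a coordinate nonzero makes the others equal -/
lemma step (n : ℕ) (u : Fin n → ℂ) (hn : 5 ≤ n)
    (h : ∀ g, ∃ c : ℂ, perm n g u = c • u) (a : Fin n) (ha : u a ≠ 0)
    (i j : Fin n) (hi : i ≠ a) (hj : j ≠ a) : u i = u j := by
  by_cases hij : i = j
  · rw [hij]
  obtain ⟨k, hk⟩ : ∃ k, k ∉ ({a, i, j} : Finset (Fin n)) := by
    by_contra! hc
    have := Finset.card_le_card (Finset.subset_iff.2 fun x (_ : x ∈ Finset.univ) => hc x)
    have h3 := Finset.card_le_three (a := a) (b := i) (c := j)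
    simp at this
    omega
  simp only [Finset.mem_insert, Finset.mem_singleton, not_or] at hk
  obtain ⟨hka, hki, hkj⟩ := hk
  let g : Equiv.Perm (Fin n) := Equiv.swap i j * Equiv.swap i k
  have hg : g ∈ alternatingGroup (Fin n) := by
    rw [Equiv.Perm.mem_alternatingGroup]
    simp [g, Equiv.Perm.sign_swap hij, Equiv.Perm.sign_swap (Ne.symm hki)]
  obtain ⟨c, hc⟩ := h ⟨g, hg⟩
  have h1 := congrFun hc a
  have h2 := congrFun hc j
  simp only [perm_apply, Pi.smul_apply, smul_eq_mul] at h1 h2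
  have ga : g⁻¹ a = a := by
    simp [g, mul_inv_rev, Equiv.swap_apply_of_ne_of_ne, hi.symm, hj.symm, Ne.symm hka]
  have gj : g⁻¹ j = k := by
    simp [g, mul_inv_rev]
  have h3 := congrFun hc i
  simp only [perm_apply, Pi.smul_apply, smul_eq_mul] at h3
  have gi : g⁻¹ i = j := by
    simp [g, mul_inv_rev, Equiv.swap_apply_of_ne_of_ne, Ne.symm hij, Ne.symm hkj]
  rw [ga] at h1
  rw [gi] at h3
  have c1 : c = 1 := by
    have : (c - 1) * u a = 0 := by linear_combination -h1
    rcases mul_eq_zero.1 this with h | h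
    · linear_combination h
    · exact absurd h ha
  rw [c1] at h3
  simpa using h3.symm

lemma no_line (n : ℕ) (hn : 5 ≤ n) (u : Fin n → ℂ) (hu : u ≠ 0) (hs : ∑ i, u i = 0)
    (h : ∀ g, ∃ c : ℂ, perm n g u = c • u) : False := by
  obtain ⟨a, ha⟩ := Function.ne_iff.1 hu
  have ha : u a ≠ 0 := ha
  obtain ⟨b, hb, hb0⟩ : ∃ b, b ≠ a ∧ u b ≠ 0 := by
    by_contra! hc
    rw [Finset.sum_eq_single a (fun b _ hb => hc b hb) (by simp)] at hs
    exact ha hs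
  obtain ⟨k, hk⟩ : ∃ k, k ∉ ({a, b} : Finset (Fin n)) := by
    by_contra! hc
    have := Finset.card_le_card (Finset.subset_iff.2 fun x (_ : x ∈ Finset.univ) => hc x)
    have h3 := Finset.card_le_two (a := a) (b := b)
    simp only [Finset.card_univ, Fintype.card_fin] at this
    omega
  simp only [Finset.mem_insert, Finset.mem_singleton, not_or] at hk
  have e1 := step n u hn h a ha
  have e2 := step n u hn h b hb0 a k hb.symm hk.2
  have e3 : ∀ i, u i = u a := by
    intro i
    by_cases hi : i = a
    · rw [hi]
    · rw [e1 i k hi hk.1, e2]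
  rw [Finset.sum_congr rfl (fun i _ => e3 i)] at hs
  simp at hs
  rcases hs with h | h
  · omega
  · exact ha h

lemma cube_lt (n : ℕ) (hn : 5 ≤ n) : 2 * n ^ 3 * 2 < 5 * n.factorial := by
  induction n, hn using Nat.le_induction with
  | base => decide
  | succ m hm ih =>
    rw [Nat.factorial_succ]
    have : (m + 1) ^ 3 ≤ (m + 1) * m ^ 3 := by
      have : (m + 1) ^ 2 ≤ m ^ 3 := by nlinarith
      calc (m + 1) ^ 3 = (m + 1) * (m + 1) ^ 2 := by ring
        _ ≤ _ := Nat.mul_le_mul_left _ this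
    nlinarith

end AltSmall

/-- For every integer `n ≥ 5` and every real `k > 5/2`, the alternating group `A_n` has
an irreducible complex character `θ` (the character of a simple finite-dimensional complex
representation) with `θ(1) > 1` such that `k · |A_n| > θ(1)^3`. -/
theorem alternating_has_small_character (n : ℕ) (hn : 5 ≤ n) (k : ℝ) (hk : k > 5 / 2) :
    ∃ V : FDRep ℂ (alternatingGroup (Fin n)), Simple V ∧ 1 < finrank ℂ V ∧
      k * (Nat.card (alternatingGroup (Fin n)) : ℝ) > (finrank ℂ V : ℝ) ^ 3 := by
  obtain ⟨σ, h0, hs, hirr⟩ := AltSmall.exists_irr n hn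
  refine ⟨FDRep.of σ.toRepresentation, AltSmall.simple_of _ hirr, ?_, ?_⟩
  · change 1 < finrank ℂ σ.toSubmodule
    by_contra! hle
    have hpos : finrank ℂ σ.toSubmodule ≠ 0 := fun h => h0 (Submodule.finrank_eq_zero.1 h)
    have h1 : finrank ℂ σ.toSubmodule = 1 := by omega
    obtain ⟨v, hv, hall⟩ := finrank_eq_one_iff'.1 h1
    refine AltSmall.no_line n hn v (fun h => hv (Subtype.ext h))
      ((AltSmall.mem_sz n _).1 (hs v.2)) (fun g => ?_)
    obtain ⟨c, hc⟩ := hall ⟨_, σ.apply_mem_toSubmodule g v.2⟩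
    exact ⟨c, (congrArg Subtype.val hc).symm⟩
  · change k * (Nat.card (alternatingGroup (Fin n)) : ℝ) > (finrank ℂ σ.toSubmodule : ℝ) ^ 3
    have hd : finrank ℂ σ.toSubmodule ≤ n := by
      simpa using Submodule.finrank_le σ.toSubmodule
    have : Nontrivial (Fin n) := Fin.nontrivial_iff_two_le.2 (by omega)
    have hcard : 2 * Nat.card (alternatingGroup (Fin n)) = n.factorial := by
      rw [Nat.card_eq_fintype_card, two_mul_card_alternatingGroup, Fintype.card_perm,
        Fintype.card_fin]
    have hc := AltSmall.cube_lt n hn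
    rw [← hcard] at hc
    have hc' : 2 * (n : ℝ) ^ 3 * 2 < 5 * (2 * (Nat.card (alternatingGroup (Fin n)) : ℝ)) := by
      exact_mod_cast hc
    have h3 : (finrank ℂ σ.toSubmodule : ℝ) ^ 3 ≤ (n : ℝ) ^ 3 := by
      gcongr
    have hp : (0 : ℝ) ≤ n ^ 3 := by positivity
    have hcp : (0 : ℝ) < Nat.card (alternatingGroup (Fin n)) := by linarith
    nlinarith [mul_lt_mul_of_pos_right hk hcp]
end

section
/- For every integer n ≥ 2 and every integer q ≥ 2, writing d := gcd(n+1, q−1), one has (1/d)·q^{n(n+1)/2}·∏_{i=2}^{n+1}(q^i − 1) > q^{n(n+1)}/(q−1). (The left-hand side is the order of the simple group A_n(q) = PSL_{n+1}(q).) -/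
theorem psl_aux (q : ℝ) (hq : 2 ≤ q) (n : ℕ) (hn : 1 ≤ n) :
    q ^ (n * (n + 1) / 2) < ∏ i ∈ Finset.Icc 2 (n + 1), (q ^ i - 1) := by
  induction n, hn using Nat.le_induction with
  | base =>
    norm_num
    nlinarith
  | succ n hn ih =>
    rw [Finset.prod_Icc_succ_top (by omega)]
    have e : (n + 1) * (n + 1 + 1) / 2 = n * (n + 1) / 2 + (n + 1) := by
      have : (n + 1) * (n + 1 + 1) = n * (n + 1) + (n + 1) * 2 := by ring
      rw [this, Nat.add_mul_div_right _ _ (by norm_num)]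
    rw [e, pow_add]
    have h1 : (1 : ℝ) ≤ q ^ (n + 1) := one_le_pow₀ (by linarith)
    have h2 : q ^ (n + 1) ≤ q ^ (n + 1 + 1) - 1 := by
      rw [pow_succ q (n + 1)]
      nlinarith
    have h0 : (0 : ℝ) < q ^ (n * (n + 1) / 2) := by positivity
    exact mul_lt_mul ih h2 (by linarith) (by linarith)

/-- For integers `n ≥ 2` and `q ≥ 2`, with `d = gcd(n+1, q-1)`, one has
`(1/d) · q^{n(n+1)/2} · ∏_{i=2}^{n+1} (q^i - 1) > q^{n(n+1)}/(q-1)`.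
The left-hand side is the order of the simple group `A_n(q) = PSL_{n+1}(q)`. -/
theorem psl_order_lower_bound (n q : ℕ) (hn : 2 ≤ n) (hq : 2 ≤ q) :
    (1 / (Nat.gcd (n + 1) (q - 1) : ℝ)) * (q : ℝ) ^ (n * (n + 1) / 2) *
      ∏ i ∈ Finset.Icc 2 (n + 1), ((q : ℝ) ^ i - 1) >
    (q : ℝ) ^ (n * (n + 1)) / ((q : ℝ) - 1) := by
  have hq' : (2 : ℝ) ≤ q := by exact_mod_cast hq
  have h := psl_aux q hq' n (by omega)
  have hd0 : (0 : ℝ) < (Nat.gcd (n + 1) (q - 1) : ℝ) := by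
    exact_mod_cast Nat.gcd_pos_of_pos_left _ (by omega)
  have hd : (Nat.gcd (n + 1) (q - 1) : ℝ) ≤ (q : ℝ) - 1 := by
    have h1 : Nat.gcd (n + 1) (q - 1) ≤ q - 1 := Nat.gcd_le_right _ (by omega)
    have h2 : ((q - 1 : ℕ) : ℝ) = (q : ℝ) - 1 := by
      rw [Nat.cast_sub (by omega)]; simp
    rw [← h2]
    exact_mod_cast h1
  have e : n * (n + 1) = n * (n + 1) / 2 + n * (n + 1) / 2 := by
    have := Nat.div_mul_cancel (Nat.even_mul_succ_self n).two_dvd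
    omega
  have h0 : (0 : ℝ) < (q : ℝ) ^ (n * (n + 1) / 2) := by positivity
  have e2 : (q : ℝ) ^ (n * (n + 1)) =
      (q : ℝ) ^ (n * (n + 1) / 2) * (q : ℝ) ^ (n * (n + 1) / 2) := by
    rw [← pow_add, ← e]
  rw [e2, gt_iff_lt, mul_assoc, one_div_mul_eq_div]
  exact div_lt_div₀ (mul_lt_mul_of_pos_left h h0) hd
    (mul_pos h0 (h0.trans h)).le hd0
end

section
/- For every integer n ≥ 3 and every prime power q, the projective special linear group PSL_n(q) over the field with q elements has an irreducible complex character θ with θ(1) > 1 such that θ(1)^3 < |PSL_n(q)|. -/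
open CategoryTheory Module Matrix

theorem simple_of_irr {G : Type} [Group G] [Finite G] {V : Type} [AddCommGroup V] [Module ℂ V]
    [FiniteDimensional ℂ V] (ρ : Representation ℂ G V) [ρ.IsIrreducible] :
    Simple (FDRep.of ρ) := by
  rw [FDRep.simple_iff_end_is_rank_one]
  rw [← Representation.IsIrreducible.finrank_intertwiningMap_self ρ]
  refine LinearEquiv.finrank_eq ?_
  refine (FDRep.forget₂HomLinearEquiv _ _).symm ≪≫ₗ Rep.homLinearEquiv _ _

theorem exists_simple (d : ℕ) {G : Type} [Group G] [Finite G] : ∀ {V : Type} [AddCommGroup V] [Module ℂ V]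
    [FiniteDimensional ℂ V] (ρ : Representation ℂ G V) (_ : ∃ g h, ρ g * ρ h ≠ ρ h * ρ g)
    (_ : finrank ℂ V ≤ d),
    ∃ W : FDRep ℂ G, Simple W ∧ 1 < finrank ℂ W ∧ finrank ℂ W ≤ d := by
  induction d with
  | zero =>
    intro V _ _ _ ρ hc hd
    obtain ⟨g, h, hgh⟩ := hc
    have : Subsingleton V := (finrank_zero_iff (R := ℂ)).1 (by omega)
    exact absurd (LinearMap.ext fun x => Subsingleton.elim _ _) hgh
  | succ d ih =>
    intro V _ _ _ ρ hc hd
    obtain ⟨g, h, hgh⟩ := hc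
    by_cases hirr : ρ.IsIrreducible
    · refine ⟨FDRep.of ρ, simple_of_irr ρ, ?_, hd⟩
      by_contra hlt
      apply hgh
      have h1 : finrank ℂ V ≤ 1 := not_lt.1 hlt
      obtain ⟨v, hv⟩ := finrank_le_one_iff.1 h1
      obtain ⟨a, ha⟩ := hv (ρ g v)
      obtain ⟨b, hb⟩ := hv (ρ h v)
      ext x
      obtain ⟨c, rfl⟩ := hv x
      simp [← ha, ← hb, smul_smul]
      congr 1; ring
    · have hnt : Nontrivial (Subrepresentation ρ) := by
        by_contra hn
        rw [not_nontrivial_iff_subsingleton] at hn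
        apply hgh
        ext x
        have hbt : (⊥ : Subrepresentation ρ) = ⊤ := Subsingleton.elim _ _
        have hall : ∀ x : V, x = 0 := fun x => by
          have : x ∈ (⊤ : Subrepresentation ρ) := trivial
          rw [← hbt] at this
          exact this
        rw [hall x]; simp
      have : ∃ S : Subrepresentation ρ, S ≠ ⊥ ∧ S ≠ ⊤ := by
        by_contra! hn
        exact hirr ⟨fun S => or_iff_not_imp_left.2 (hn S)⟩
      obtain ⟨S, hS0, hS1⟩ := this
      obtain ⟨T, hST⟩ := exists_isCompl S
      have key : ∀ S : Subrepresentation ρ, S ≠ ⊤ →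
          (∃ W : FDRep ℂ G, Simple W ∧ 1 < finrank ℂ W ∧ finrank ℂ W ≤ d + 1) ∨
          ∀ x ∈ S, ρ g (ρ h x) = ρ h (ρ g x) := by
        intro S hS
        by_cases hc : ∃ g h, S.toRepresentation g * S.toRepresentation h
            ≠ S.toRepresentation h * S.toRepresentation g
        · left
          have hlt : finrank ℂ S.toSubmodule < finrank ℂ V := by
            apply Submodule.finrank_lt
            intro h
            apply hS
            apply Subrepresentation.toSubmodule_injective
            exact h
          obtain ⟨W, h1, h2, h3⟩ := ih S.toRepresentation hc (by omega)
          exact ⟨W, h1, h2, by omega⟩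
        · right
          push Not at hc
          intro x hx
          exact congrArg Subtype.val (LinearMap.congr_fun (hc g h) ⟨x, hx⟩)
      rcases key S hS1 with h1 | h1
      · exact h1
      rcases key T (by rintro rfl; exact hS0 (by simpa using hST.disjoint)) with h2 | h2
      · exact h2
      exfalso
      apply hgh
      ext x
      have : x ∈ S ⊔ T := by rw [hST.sup_eq_top]; trivial
      obtain ⟨y, hy, z, hz, rfl⟩ := Submodule.mem_sup.1 (show x ∈ S.toSubmodule ⊔ T.toSubmodule from this)
      simp [h1 y hy, h2 z hz]

theorem card_PSL (n : ℕ) (hn : 3 ≤ n) (F : Type) [Field F] [Fintype F] :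
    ∃ z r : ℕ, 0 < z ∧ 0 < r ∧ z ≤ Fintype.card F - 1 ∧ r ≤ Fintype.card F - 1 ∧
      Nat.card (ProjectiveSpecialLinearGroup (Fin n) F) * z * r =
        ∏ i ∈ Finset.range n, (Fintype.card F ^ n - Fintype.card F ^ i) := by
  classical
  have : NeZero n := ⟨by omega⟩
  have hu : Nat.card Fˣ = Fintype.card F - 1 := by
    rw [Nat.card_eq_fintype_card, Fintype.card_units]
  refine ⟨Nat.card (Subgroup.center (SpecialLinearGroup (Fin n) F)),
    Nat.card (GeneralLinearGroup.det (n := Fin n) (R := F)).range, Nat.card_pos, Nat.card_pos,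
    ?_, ?_, ?_⟩
  · rw [← hu, Nat.card_congr (SpecialLinearGroup.center_equiv_rootsOfUnity
      (n := Fin n) (R := F)).toEquiv]
    exact Subgroup.card_le_card_group _
  · rw [← hu]
    exact Subgroup.card_le_card_group _
  · rw [← Subgroup.card_eq_card_quotient_mul_card_subgroup]
    have h2 := Subgroup.card_eq_card_quotient_mul_card_subgroup
      (GeneralLinearGroup.det (n := Fin n) (R := F)).ker
    rw [Nat.card_congr (QuotientGroup.quotientKerEquivRange
      (GeneralLinearGroup.det (n := Fin n) (R := F))).toEquiv] at h2
    rw [Finset.prod_range, ← card_GL_field n, h2, mul_comm]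
    congr 1
    refine Nat.card_congr (Equiv.ofBijective
      (fun A => ⟨SpecialLinearGroup.toGL A, ?_⟩) ⟨?_, ?_⟩)
    · rw [MonoidHom.mem_ker]; ext; simp
    · intro A B h
      have := congrArg (fun x => ((x.1 : GL (Fin n) F) : Matrix (Fin n) (Fin n) F)) h
      exact Subtype.ext this
    · rintro ⟨A, hA⟩
      rw [MonoidHom.mem_ker] at hA
      refine ⟨⟨A.1, ?_⟩, ?_⟩
      · have := congrArg Units.val hA
        simpa using this
      · apply Subtype.ext; ext; rfl

theorem arith_s9 (n q : ℕ) (hn : 3 ≤ n) (hq : 2 ≤ q) (h : n = 3 → q ≠ 2) :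
    (q ^ n - 1) ^ 2 < (∏ i ∈ Finset.range (n - 1), (q ^ n - q ^ (i + 1))) * (q - 1) := by
  rcases Nat.lt_or_ge 3 n with h4 | h4
  · obtain ⟨m, rfl⟩ : ∃ m, n = m + 4 := ⟨n - 4, by omega⟩
    have e1 : m + 4 - 1 = m + 1 + 1 + 1 := by omega
    rw [e1, Finset.prod_range_succ, Finset.prod_range_succ, Finset.prod_range_succ]
    have hpos : 1 ≤ ∏ i ∈ Finset.range m, (q ^ (m + 4) - q ^ (i + 1)) := by
      apply Nat.succ_le_of_lt
      apply Finset.prod_pos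
      intro i hi
      rw [Finset.mem_range] at hi
      exact Nat.sub_pos_of_lt (Nat.pow_lt_pow_right (by omega) (by omega))
    have hX : q ≤ q ^ (m + 1) := Nat.le_self_pow (by omega) q
    obtain ⟨k, rfl⟩ : ∃ k, q = k + 2 := ⟨q - 2, by omega⟩
    set X := (k + 2) ^ (m + 1) with hXd
    have f0 : (k + 2) ^ (m + 4) = X * (k + 2) ^ 3 := by rw [hXd]; ring
    have f1 : (k + 2) ^ (m + 4) - (k + 2) ^ (m + 1) = X * (k^3+6*k^2+12*k+7) := by
      rw [f0, ← hXd]; apply Nat.sub_eq_of_eq_add; ring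
    have f2 : (k + 2) ^ (m + 4) - (k + 2) ^ (m + 1 + 1) = X * ((k + 2) * (k^2+4*k+3)) := by
      rw [f0, pow_succ _ (m+1), ← hXd]; apply Nat.sub_eq_of_eq_add; ring
    have f3 : (k + 2) ^ (m + 4) - (k + 2) ^ (m + 1 + 1 + 1) = X * ((k + 2) ^ 2 * (k + 1)) := by
      rw [f0, pow_succ _ (m+1+1), pow_succ _ (m+1), ← hXd]; apply Nat.sub_eq_of_eq_add; ring
    rw [f1, f2, f3]
    have g : ((k + 2) ^ (m + 4) - 1) ^ 2 < (X * (k + 2) ^ 3) ^ 2 := by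
      rw [f0]
      apply Nat.pow_lt_pow_left _ (by norm_num)
      apply Nat.sub_lt _ one_pos
      positivity
    refine lt_of_lt_of_le g ?_
    have hk : k + 2 - 1 = k + 1 := by omega
    rw [hk]
    have step : (X * (k + 2) ^ 3) ^ 2 ≤ 1 * (X * (k^3+6*k^2+12*k+7)) * (X * ((k + 2) * (k^2+4*k+3))) *
        (X * ((k + 2) ^ 2 * (k + 1))) * (k + 1) := by
      have : 1 * (X * (k^3+6*k^2+12*k+7)) * (X * ((k + 2) * (k^2+4*k+3))) *
        (X * ((k + 2) ^ 2 * (k + 1))) * (k + 1) = (X^2 * (k+2)^3) * (X * ((k^3+6*k^2+12*k+7) * ((k^2+4*k+3) * ((k+1)*(k+1))))) := by ring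
      rw [this]
      have : (X * (k + 2) ^ 3) ^ 2 = (X^2 * (k+2)^3) * ((k+2) * ((k+2)^2 * 1)) := by ring
      rw [this]
      refine Nat.mul_le_mul le_rfl (Nat.mul_le_mul hX (Nat.mul_le_mul ?_ ?_))
      · nlinarith [sq_nonneg k, Nat.zero_le (k^3)]
      · exact Nat.succ_le_of_lt (by positivity)
    refine step.trans ?_
    gcongr
  · obtain rfl : n = 3 := by omega
    obtain ⟨k, rfl⟩ : ∃ k, q = k + 3 := ⟨q - 3, by have := h rfl; omega⟩
    simp only [Finset.prod_range_succ, Finset.prod_range_zero, show 3 - 1 = 2 from rfl]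
    have f0 : (k + 3) ^ 3 - 1 = k^3+9*k^2+27*k+26 := by
      apply Nat.sub_eq_of_eq_add; ring
    have f1 : (k + 3) ^ 3 - (k+3)^(0+1) = k^3+9*k^2+26*k+24 := by
      apply Nat.sub_eq_of_eq_add; ring
    have f2 : (k + 3) ^ 3 - (k+3)^(1+1) = k^3+8*k^2+21*k+18 := by
      apply Nat.sub_eq_of_eq_add; ring
    have f3 : k + 3 - 1 = k + 2 := by omega
    rw [f0, f1, f2, f3]
    ring_nf
    nlinarith [Nat.zero_le k, Nat.zero_le (k^2), Nat.zero_le (k^3), Nat.zero_le (k^4), Nat.zero_le (k^5), Nat.zero_le (k^6), Nat.zero_le (k^7)]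

theorem final_arith (n q N P z r : ℕ) (hn : 3 ≤ n) (hq : 2 ≤ q) (h : n = 3 → q ≠ 2)
    (hN : q ^ n - 1 = N * (q - 1)) (hz : z ≤ q - 1) (hr : r ≤ q - 1)
    (hP : P * z * r = ∏ i ∈ Finset.range n, (q ^ n - q ^ i)) : N ^ 3 < P := by
  by_contra hc
  rw [not_lt] at hc
  obtain ⟨m, rfl⟩ : ∃ m, n = m + 1 := ⟨n - 1, by omega⟩
  have ha := arith_s9 _ q hn hq h
  rw [Finset.prod_range_succ'] at hP
  simp only [Nat.add_sub_cancel, pow_zero] at ha hP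
  set R := ∏ i ∈ Finset.range m, (q ^ (m + 1) - q ^ (i + 1))
  have hpos : 0 < q ^ (m + 1) - 1 := Nat.sub_pos_of_lt (Nat.one_lt_pow (by omega) (by omega))
  have h1 : P * z * r ≤ N ^ 3 * (q - 1) * (q - 1) := by gcongr
  have h2 : (R * (q ^ (m + 1) - 1)) * (q - 1) ≤ (q ^ (m + 1) - 1) ^ 2 * (q ^ (m + 1) - 1) := by
    rw [← hP, ← pow_succ, hN, mul_pow]
    calc _ ≤ N ^ 3 * (q - 1) * (q - 1) * (q - 1) := by gcongr
      _ = _ := by ring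
  have h3 : R * (q - 1) ≤ (q ^ (m + 1) - 1) ^ 2 := by
    apply Nat.le_of_mul_le_mul_right _ hpos
    calc _ = _ := by ring
      _ ≤ _ := h2
  omega

theorem noncomm_proj (n : ℕ) (hn : 3 ≤ n) (F : Type) [Field F] [Fintype F] :
    ∃ g h, Representation.ofMulAction ℂ (ProjectiveSpecialLinearGroup (Fin n) F)
        (Projectivization F (Fin n → F)) g *
      Representation.ofMulAction ℂ (ProjectiveSpecialLinearGroup (Fin n) F)
        (Projectivization F (Fin n → F)) h ≠
      Representation.ofMulAction ℂ (ProjectiveSpecialLinearGroup (Fin n) F)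
        (Projectivization F (Fin n → F)) h *
      Representation.ofMulAction ℂ (ProjectiveSpecialLinearGroup (Fin n) F)
        (Projectivization F (Fin n → F)) g := by
  let i0 : Fin n := ⟨0, by omega⟩
  let i1 : Fin n := ⟨1, by omega⟩
  let i2 : Fin n := ⟨2, by omega⟩
  have h01 : i0 ≠ i1 := by simp [i0, i1]
  have h12 : i1 ≠ i2 := by simp [i1, i2]
  have h02 : i0 ≠ i2 := by simp [i0, i2]
  let a := SpecialLinearGroup.transvection h01 (1 : F)
  let b := SpecialLinearGroup.transvection h12 (1 : F)
  refine ⟨(a : ProjectiveSpecialLinearGroup (Fin n) F), (b : ProjectiveSpecialLinearGroup (Fin n) F), ?_⟩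
  intro heq
  have hv : (Pi.single i2 1 : Fin n → F) ≠ 0 := by simp
  have h1 := LinearMap.congr_fun heq (MonoidAlgebra.single (Projectivization.mk F _ hv) 1)
  simp only [Module.End.mul_apply, Representation.ofMulAction_single] at h1
  have h2 := MonoidAlgebra.single_left_injective (one_ne_zero) h1
  simp only [ProjectiveSpecialLinearGroup.smul_proj_mk, Projectivization.smul_mk,
    Projectivization.mk_eq_mk_iff] at h2
  obtain ⟨u, hu⟩ := h2
  have ha2 : a • (Pi.single i2 1 : Fin n → F) = Pi.single i2 1 := by
    change (SpecialLinearGroup.transvection h01 (1 : F)) • (Pi.single i2 1 : Fin n → F) = _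
    rw [Matrix.SpecialLinearGroup.smul_def, Matrix.smul_eq_mulVec, SpecialLinearGroup.transvection_coe,
      Matrix.add_mulVec, Matrix.one_mulVec, add_eq_left]
    ext k
    simp [Matrix.single, h12]
  have hb2 : b • (Pi.single i2 1 : Fin n → F) = Pi.single i2 1 + (1 : F) • Pi.single i1 1 :=
    SpecialLinearGroup.transvection_smul_single_snd h12 1
  have ha1 : a • (Pi.single i1 1 : Fin n → F) = Pi.single i1 1 + (1 : F) • Pi.single i0 1 :=
    SpecialLinearGroup.transvection_smul_single_snd h01 1
  rw [ha2, hb2, smul_add a, ha2, one_smul, ha1] at hu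
  have := congrFun hu i0
  simp [h01, h02, h12, Units.smul_def] at this
theorem squares_sum {ι : Type} (S : Finset ι) (d : ι → ℕ) (h : ∀ i ∈ S, 6 ≤ d i) :
    ∑ i ∈ S, d i ^ 2 ≠ 167 ∧ ∑ i ∈ S, d i ^ 2 ≠ 168 := by
  let T : Finset ℕ := {0, 36, 49, 64, 72, 81, 85, 98, 100, 108, 113, 117, 121, 128, 130, 134, 136,
    144, 145, 147, 149, 153, 157, 162, 164, 166}
  have hT : ∀ a ∈ T, ∀ b ∈ T, 169 ≤ a + b ∨ a + b ∈ T := by decide +kernel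
  have key : 169 ≤ ∑ i ∈ S, d i ^ 2 ∨ ∑ i ∈ S, d i ^ 2 ∈ T := by
    apply Finset.sum_induction (fun i => d i ^ 2) (fun m => 169 ≤ m ∨ m ∈ T)
    · rintro a b (ha | ha) (hb | hb)
      · left; omega
      · left; omega
      · left; omega
      · exact hT a ha b hb
    · right; decide
    · intro i hi
      have h6 := h i hi
      by_cases h13 : 13 ≤ d i
      · left; nlinarith
      · right
        have : d i < 13 := by omega
        generalize d i = x at *
        interval_cases x <;> decide
  constructor
  · intro h
    rw [h] at key
    revert key; decide
  · intro h
    rw [h] at key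
    revert key; decide

theorem perfect_SL3 (F : Type) [Field F] [Fintype F] (hF : Fintype.card F = 2)
    (f : SpecialLinearGroup (Fin 3) F →* ℂ) (A : SpecialLinearGroup (Fin 3) F) : f A = 1 := by
  have h01 : ∀ c : F, c ≠ 0 → c = 1 := by
    intro c hc
    have := FiniteField.pow_card_sub_one_eq_one c hc
    simpa [hF] using this
  have hne : ∀ B, f B ≠ 0 := by
    intro B hB
    have : f (B * B⁻¹) = 1 := by simp
    rw [map_mul, hB, zero_mul] at this
    exact zero_ne_one this
  induction A using SpecialLinearGroup.diagonal_transvection_induction' with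
  | hdiag i j hij hc =>
    rename_i c
    obtain rfl := h01 c hc
    have : SpecialLinearGroup.diag2n hij (1 : F) hc = 1 := by
      ext k l
      simp [SpecialLinearGroup.diag2n]
    rw [this, map_one]
  | htransvec i j hij a =>
    obtain ⟨k, hik, hkj⟩ : ∃ k : Fin 3, i ≠ k ∧ k ≠ j := by
      revert i j; decide
    have : SpecialLinearGroup.transvection hik a * SpecialLinearGroup.transvection hkj (1 : F) =
      SpecialLinearGroup.transvection hij a * (SpecialLinearGroup.transvection hkj (1 : F) *
        SpecialLinearGroup.transvection hik a) := by
      apply Subtype.ext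
      simp [SpecialLinearGroup.transvection_coe, mul_add, add_mul, hij, hik, hkj, hij.symm, hik.symm, hkj.symm]
      abel
    have h2 := congrArg f this
    simp only [map_mul] at h2
    have n1 := hne (SpecialLinearGroup.transvection hik a)
    have n2 := hne (SpecialLinearGroup.transvection hkj (1 : F))
    apply mul_right_cancel₀ (mul_ne_zero n2 n1)
    rw [← h2]; ring
  | hmul A B hA hB => rw [map_mul, hA, hB, one_mul]

theorem perfect_168 {G : Type} [Group G] [Finite G] (hG : ∀ (f : G →* ℂ) (g : G), f g = 1)
    (hcard : Nat.card G = 168) :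
    ∃ W : FDRep ℂ G, Simple W ∧ 1 < finrank ℂ W ∧ finrank ℂ W ≤ 5 := by
  classical
  obtain ⟨n, d, hd, ⟨e⟩⟩ :=
    IsSemisimpleRing.exists_algEquiv_pi_matrix_of_isAlgClosed ℂ (MonoidAlgebra ℂ G)
  let φ : ∀ i, G →* Matrix (Fin (d i)) (Fin (d i)) ℂ := fun i =>
    ((Pi.evalAlgHom ℂ (fun i => Matrix (Fin (d i)) (Fin (d i)) ℂ) i).comp
      e.toAlgHom : MonoidAlgebra ℂ G →* _).comp (MonoidAlgebra.of ℂ G)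
  have hφ : ∀ i g, φ i g = e (MonoidAlgebra.single g 1) i := fun i g => rfl
  by_cases hex : ∃ i, 2 ≤ d i ∧ d i ≤ 5
  · obtain ⟨i, h2, h5⟩ := hex
    let ρ : Representation ℂ G (Fin (d i) → ℂ) :=
      ((Matrix.toLinAlgEquiv' : Matrix (Fin (d i)) (Fin (d i)) ℂ ≃ₐ[ℂ] _) :
        Matrix (Fin (d i)) (Fin (d i)) ℂ →* _).comp (φ i)
    apply exists_simple 5 ρ _ (by simpa using h5)
    by_contra! hc
    have hc1 : ∀ g h, φ i g * φ i h = φ i h * φ i g := by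
      intro g h
      apply (Matrix.toLinAlgEquiv' : Matrix (Fin (d i)) (Fin (d i)) ℂ ≃ₐ[ℂ] _).injective
      rw [map_mul, map_mul]
      exact hc g h
    have hc2 : ∀ x y : MonoidAlgebra ℂ G, e x i * e y i = e y i * e x i := by
      intro x y
      induction x using MonoidAlgebra.induction_linear with
      | zero => simp
      | add x x' hx hx' => simp [add_mul, mul_add, hx, hx']
      | single g a =>
        induction y using MonoidAlgebra.induction_linear with
        | zero => simp
        | add x x' hx hx' => simp [add_mul, mul_add, hx, hx']
        | single h b =>
          have ea : MonoidAlgebra.single g a = a • MonoidAlgebra.single g (1 : ℂ) := by simp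
          have eb : MonoidAlgebra.single h b = b • MonoidAlgebra.single h (1 : ℂ) := by simp
          rw [ea, eb, map_smul, map_smul, Pi.smul_apply, Pi.smul_apply, ← hφ, ← hφ]
          simp only [smul_mul_smul_comm, hc1 g h, mul_comm a b]
    let i0 : Fin (d i) := ⟨0, by omega⟩
    let i1 : Fin (d i) := ⟨1, by omega⟩
    have hne : i0 ≠ i1 := by simp [i0, i1]
    have := hc2 (e.symm (Pi.single i (Matrix.single i0 i1 1)))
      (e.symm (Pi.single i (Matrix.single i1 i0 1)))
    simp only [AlgEquiv.apply_symm_apply, Pi.single_eq_same, Matrix.single_mul_single_same] at this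
    have := congrFun (congrFun this i0) i0
    simp [Matrix.single, hne.symm] at this
  · exfalso
    push Not at hex
    have htr : ∀ (k : ℕ) (_ : k = 1) (M : Matrix (Fin k) (Fin k) ℂ), M.trace = M.det := by
      rintro k rfl M; simp [Matrix.trace]
    have huniq : ∀ i j, d i = 1 → d j = 1 → i = j := by
      intro i j hi hj
      by_contra hij
      let L : ∀ i, MonoidAlgebra ℂ G →ₗ[ℂ] ℂ := fun i =>
        (Matrix.traceLinearMap (Fin (d i)) ℂ ℂ) ∘ₗ (LinearMap.proj i) ∘ₗ e.toLinearMap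
      have hL : ∀ i x, L i x = (e x i).trace := fun i x => rfl
      have h1 : ∀ i, d i = 1 → ∀ g, L i (MonoidAlgebra.single g 1) = 1 := by
        intro i hi g
        rw [hL, htr _ hi, ← hφ]
        exact hG (Matrix.detMonoidHom.comp (φ i)) g
      have h2 : ∀ x, L i x = L j x := by
        intro x
        induction x using MonoidAlgebra.induction_linear with
        | zero => simp
        | add x x' hx hx' => simp [hx, hx']
        | single g a =>
          have ea : MonoidAlgebra.single g a = a • MonoidAlgebra.single g (1 : ℂ) := by simp
          rw [ea, map_smul, map_smul, h1 i hi, h1 j hj]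
      have h3 := h2 (e.symm (Pi.single i 1))
      rw [hL, hL, AlgEquiv.apply_symm_apply, Pi.single_eq_same,
        Pi.single_eq_of_ne (Ne.symm hij)] at h3
      simp [hi] at h3
    have hsum : ∑ i, d i ^ 2 = 168 := by
      have h1 := e.toLinearEquiv.finrank_eq
      rw [Module.finrank_pi_fintype] at h1
      simp only [Module.finrank_matrix, Fintype.card_fin, Module.finrank_self, mul_one] at h1
      have h2 : finrank ℂ (MonoidAlgebra ℂ G) = 168 := by
        have : Fintype G := Fintype.ofFinite G
        rw [← hcard, (MonoidAlgebra.coeffLinearEquiv ℂ).finrank_eq, Module.finrank_finsupp_self,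
          Nat.card_eq_fintype_card]
      rw [← h2, h1]
      exact Finset.sum_congr rfl fun i _ => sq _
    have hS := squares_sum (Finset.univ.filter fun i => ¬ d i = 1) d (by
      intro i hi
      have h1 := (Finset.mem_filter.1 hi).2
      have h2 := (hd i).ne
      have h3 := hex i
      omega)
    rw [← Finset.sum_filter_add_sum_filter_not Finset.univ (fun i => d i = 1)] at hsum
    have hle : ∑ i with d i = 1, d i ^ 2 ≤ 1 := by
      rw [Finset.sum_congr rfl (g := fun _ => 1) (fun i hi => by simp [(Finset.mem_filter.1 hi).2])]
      rw [Finset.sum_const, smul_eq_mul, mul_one, Finset.card_le_one]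
      intro i hi j hj
      exact huniq i j (Finset.mem_filter.1 hi).2 (Finset.mem_filter.1 hj).2
    omega

/-- For every integer `n ≥ 3` and every prime power `q` (i.e. for every finite field `F`
with `q` elements), the projective special linear group `PSL_n(q)`, the quotient of
`SL_n(F_q)` by its center, has an irreducible complex character `θ` (the character of a
simple finite-dimensional complex representation) with `θ(1) > 1` such that
`θ(1)^3 < |PSL_n(q)|`. -/
theorem psl_has_small_character (n : ℕ) (hn : 3 ≤ n) (F : Type) [Field F] [Fintype F] :
    ∃ V : FDRep ℂ (ProjectiveSpecialLinearGroup (Fin n) F), Simple V ∧ 1 < finrank ℂ V ∧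
      (finrank ℂ V : ℝ) ^ 3 < (Nat.card (ProjectiveSpecialLinearGroup (Fin n) F) : ℝ) := by
  have hq : 2 ≤ Fintype.card F := Fintype.one_lt_card
  obtain ⟨z, r, hz0, hr0, hz, hr, hP⟩ := card_PSL n hn F
  by_cases hs : n = 3 ∧ Fintype.card F = 2
  · obtain ⟨rfl, h2⟩ := hs
    have hz1 : z = 1 := by omega
    have hr1 : r = 1 := by omega
    have hcard : Nat.card (ProjectiveSpecialLinearGroup (Fin 3) F) = 168 := by
      rw [hz1, hr1, h2, mul_one, mul_one] at hP
      rw [hP]; decide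
    obtain ⟨W, h1, h2, h3⟩ := perfect_168 (G := ProjectiveSpecialLinearGroup (Fin 3) F) (by
      intro f g
      obtain ⟨A, rfl⟩ := QuotientGroup.mk_surjective g
      exact perfect_SL3 F h2 (f.comp (QuotientGroup.mk' _)) A) hcard
    refine ⟨W, h1, h2, ?_⟩
    rw [hcard]
    have : finrank ℂ W ^ 3 ≤ 5 ^ 3 := Nat.pow_le_pow_left h3 3
    have : finrank ℂ W ^ 3 < 168 := by omega
    exact_mod_cast this
  · have hN := Projectivization.card F (Fin n → F)
    rw [Nat.card_eq_fintype_card, Fintype.card_fun, Fintype.card_fin,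
      Nat.card_eq_fintype_card (α := F)] at hN
    have hlt := final_arith n _ _ _ z r hn hq (fun a b => hs ⟨a, b⟩) hN hz hr hP
    have : Fintype (Projectivization F (Fin n → F)) := Fintype.ofFinite _
    have : FiniteDimensional ℂ (MonoidAlgebra ℂ (Projectivization F (Fin n → F))) :=
      Module.Finite.equiv (MonoidAlgebra.coeffLinearEquiv ℂ).symm
    obtain ⟨W, h1, h2, h3⟩ := exists_simple (Nat.card (Projectivization F (Fin n → F)))
      (Representation.ofMulAction ℂ (ProjectiveSpecialLinearGroup (Fin n) F)
        (Projectivization F (Fin n → F))) (noncomm_proj n hn F) (by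
        rw [(MonoidAlgebra.coeffLinearEquiv ℂ).finrank_eq, Module.finrank_finsupp_self,
          Nat.card_eq_fintype_card])
    refine ⟨W, h1, h2, ?_⟩
    have := lt_of_le_of_lt (Nat.pow_le_pow_left h3 3) hlt
    exact_mod_cast this
end
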